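/- arXiv:1502.07565 — 4 statements merged into one kernel-verified Lean document; each statement's English description precedes it below -/
import Mathlib

section
/- Let T > 0, let L be a positive integer, let S be a measurable space, and work on a probability space Ω. Let W : Ω → S be measurable (the shared key together with all channel knowledge available to the eavesdropper), let U : Ω → (Fin L → AddCircle T) be such that its coordinates U_0, …, U_{L−1} are i.i.d. uniform on AddCircle T, and assume U is independent of W. Let V : S → (Fin L → AddCircle T) be any measurable map (the key- and channel-dependent transmitted phases). Then the observed phase vector Z : Ω → (Fin L → AddCircle T) defined by Z(ω)_k = V(W(ω))_k + U(ω)_k satisfies: (i) the law of Z is the product over k of uniform measures on AddCircle T (so the Z_k are themselves i.i.d. uniform), and (ii) Z is independent of W. Consequently the eavesdropper's observation carries zero information about the key: I(Z; W) = 0. -/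
open MeasureTheory ProbabilityTheory

/-- One-time-pad principle: adding a measurable function of `W` to a random variable `U` that is
independent of `W` and has a translation-invariant law `μ` gives a random variable with law `μ`
that is still independent of `W`. -/
theorem map_add_eq_and_indepFun_of_isAddLeftInvariant
    {Ω S G : Type*} [MeasurableSpace Ω] [MeasurableSpace S] [MeasurableSpace G]
    [AddGroup G] [MeasurableAdd₂ G] {P : Measure Ω} [IsProbabilityMeasure P]
    {μ : Measure G} [IsProbabilityMeasure μ] [μ.IsAddLeftInvariant]
    {W : Ω → S} (hW : Measurable W) {U : Ω → G} (hU : Measurable U) (hμ : P.map U = μ)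
    (hUW : IndepFun U W P) {V : S → G} (hV : Measurable V) :
    P.map (fun ω => V (W ω) + U ω) = μ ∧ IndepFun (fun ω => V (W ω) + U ω) W P := by
  have : IsProbabilityMeasure (P.map W) := Measure.isProbabilityMeasure_map hW.aemeasurable
  have hZ : Measurable fun ω => V (W ω) + U ω := (hV.comp hW).add hU
  have shear : MeasurePreserving (fun p : S × G => (p.1, V p.1 + p.2))
      ((P.map W).prod μ) ((P.map W).prod μ) :=
    (MeasurePreserving.id _).skew_product (g := fun s x => V s + x)
      ((hV.comp measurable_fst).add measurable_snd)
      (Filter.Eventually.of_forall fun s => map_add_left_eq_self μ (V s))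
  have joint : P.map (fun ω => (W ω, U ω)) = (P.map W).prod μ := by
    rw [hUW.symm.map_prod_eq_prod_map_map hW.aemeasurable hU.aemeasurable, hμ]
  have joint' : P.map (fun ω => (W ω, V (W ω) + U ω)) = (P.map W).prod μ := by
    have h := shear.map_eq
    rw [← joint, Measure.map_map shear.measurable (hW.prodMk hU)] at h
    exact h.trans joint
  have law : P.map (fun ω => V (W ω) + U ω) = μ := by
    have h := congrArg Measure.snd joint'
    rwa [Measure.snd_map_prodMk hW, Measure.snd_prod] at h
  refine ⟨law, IndepFun.symm ?_⟩
  rw [indepFun_iff_map_prod_eq_prod_map_map hW.aemeasurable hZ.aemeasurable, law, joint']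

/-- **Information-theoretic security with i.i.d. uniform phases (Section IV.B).**
Let `W` be the key/channel knowledge of the eavesdropper, let `U` be a vector of `L` i.i.d.
uniform phases on `AddCircle T` independent of `W`, and let `V` be any measurable map giving
the key- and channel-dependent transmitted phases.  Then the observed phase vector
`Z ω k = V (W ω) k + U ω k` is itself a vector of i.i.d. uniform phases, and `Z` is
independent of `W` — hence the eavesdropper's observation carries zero information about the
key: `I(Z; W) = 0`. -/
theorem observation_iid_uniform_and_indep_of_key
    {T : ℝ} [hT : Fact (0 < T)]
    {Ω : Type*} [MeasureSpace Ω] [IsProbabilityMeasure (ℙ : Measure Ω)]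
    {S : Type*} [MeasurableSpace S] {L : ℕ} (hL : 0 < L)
    (W : Ω → S) (hW : Measurable W)
    (U : Ω → (Fin L → AddCircle T)) (hU : Measurable U)
    (hUiid : Measure.map U ℙ
      = Measure.pi (fun _ : Fin L => (AddCircle.haarAddCircle : Measure (AddCircle T))))
    (hUW : IndepFun U W)
    (V : S → (Fin L → AddCircle T)) (hV : Measurable V)
    (Z : Ω → (Fin L → AddCircle T)) (hZ : ∀ ω k, Z ω k = V (W ω) k + U ω k) :
    Measure.map Z ℙ
        = Measure.pi (fun _ : Fin L => (AddCircle.haarAddCircle : Measure (AddCircle T))) ∧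
      IndepFun Z W := by
  obtain rfl : Z = fun ω => V (W ω) + U ω := funext fun ω => funext (hZ ω)
  exact map_add_eq_and_indepFun_of_isAddLeftInvariant hW hU hUiid hUW hV
end

section
/- For all real numbers A and B, ∫₀^{2π} e^{A cos λ + B sin λ} dλ = 2π · I₀(√(A² + B²)), where I₀(x) = Σ_{k=0}^{∞} (x/2)^{2k} / (k!)². -/
open MeasureTheory Real

/-- The modified Bessel function of the first kind and order `0`, defined by its
everywhere-convergent power series `I₀(x) = ∑_{k=0}^∞ (x/2)^{2k} / (k!)²`. -/
noncomputable def besselI0 (x : ℝ) : ℝ := ∑' k : ℕ, (x / 2) ^ (2 * k) / ((Nat.factorial k : ℝ)) ^ 2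

theorem integral_sin_pow_odd_zero_two_pi (n : ℕ) :
    ∫ x in (0 : ℝ)..(2 * π), sin x ^ (2 * n + 1) = 0 := by
  induction n with
  | zero => simp
  | succ n ih =>
    rw [show 2 * (n + 1) + 1 = 2 * n + 1 + 2 by ring, integral_sin_pow, ih]
    simp

theorem integral_sin_pow_even_zero_two_pi (n : ℕ) :
    ∫ x in (0 : ℝ)..(2 * π), sin x ^ (2 * n) =
      2 * π * ((Nat.factorial (2 * n) : ℝ) / (2 ^ (2 * n) * (Nat.factorial n : ℝ) ^ 2)) := by
  induction n with
  | zero => simp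
  | succ n ih =>
    rw [show 2 * (n + 1) = 2 * n + 2 by ring, integral_sin_pow, ih]
    simp only [Nat.factorial_succ, sin_zero, sin_two_pi]
    push_cast
    field_simp
    ring

theorem hasSum_exp_mul_sin_integral (r : ℝ) :
    HasSum (fun n : ℕ => ∫ x in (0 : ℝ)..(2 * π), (r * sin x) ^ n / (Nat.factorial n : ℝ))
      (∫ x in (0 : ℝ)..(2 * π), exp (r * sin x)) := by
  apply intervalIntegral.hasSum_integral_of_dominated_convergence
    (fun n _ => |r| ^ n / (Nat.factorial n : ℝ))
  · exact fun n => Continuous.aestronglyMeasurable (by fun_prop)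
  · refine fun n => ae_of_all _ fun x _ => ?_
    rw [norm_div, norm_pow, norm_mul, norm_eq_abs, norm_eq_abs, RCLike.norm_natCast]
    gcongr
    exact mul_le_of_le_one_right (abs_nonneg r) (abs_sin_le_one x)
  · exact ae_of_all _ fun _ _ => summable_pow_div_factorial |r|
  · exact intervalIntegrable_const
  · refine ae_of_all _ fun x _ => ?_
    rw [exp_eq_exp_ℝ]
    exact NormedSpace.expSeries_div_hasSum_exp (r * sin x)

theorem integral_exp_mul_sin (r : ℝ) :
    ∫ x in (0 : ℝ)..(2 * π), exp (r * sin x) = 2 * π * besselI0 r := by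
  have h := hasSum_exp_mul_sin_integral r
  rw [← Function.Injective.hasSum_iff (mul_right_injective₀ (two_ne_zero' ℕ))] at h
  · rw [besselI0, ← tsum_mul_left, ← h.tsum_eq]
    refine tsum_congr fun k => ?_
    simp only [Function.comp_apply, mul_pow, intervalIntegral.integral_div,
      intervalIntegral.integral_const_mul, integral_sin_pow_even_zero_two_pi, div_pow]
    field_simp
  · intro n hn
    obtain ⟨k, rfl⟩ : Odd n := by
      rw [← Nat.not_even_iff_odd, even_iff_exists_two_mul]
      exact fun ⟨k, hk⟩ => hn ⟨k, hk.symm⟩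
    simp [mul_pow, integral_sin_pow_odd_zero_two_pi]

/-- **Bessel integral identity.**  For all real `A` and `B`,
`∫₀^{2π} e^{A cos λ + B sin λ} dλ = 2π I₀(√(A² + B²))`. -/
theorem integral_exp_cos_sin (A B : ℝ) :
    (∫ lam in (0:ℝ)..(2 * Real.pi), Real.exp (A * Real.cos lam + B * Real.sin lam))
      = 2 * Real.pi * besselI0 (Real.sqrt (A ^ 2 + B ^ 2)) := by
  set z : ℂ := ⟨B, A⟩
  have hz : ‖z‖ = √(A ^ 2 + B ^ 2) := by
    rw [Complex.norm_eq_sqrt_sq_add_sq, add_comm]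
  have hB : ‖z‖ * cos z.arg = B := Complex.norm_mul_cos_arg z
  have hA : ‖z‖ * sin z.arg = A := Complex.norm_mul_sin_arg z
  have hper : Function.Periodic (fun x => exp (‖z‖ * sin x)) (2 * π) := fun x => by
    simp only [sin_add_two_pi]
  have hshift := hper.intervalIntegral_add_eq z.arg 0
  rw [← hz, ← integral_exp_mul_sin]
  calc
    _ = ∫ x in (0 : ℝ)..(2 * π), exp (‖z‖ * sin (x + z.arg)) := by
      congr 1 with x
      rw [sin_add]
      congr 1
      linear_combination (-cos x) * hA - sin x * hB
    _ = _ := by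
      rw [intervalIntegral.integral_comp_add_right (fun x => exp (‖z‖ * sin x))]
      simpa [add_comm] using hshift
end

section
/- Let N be a positive integer, ϑ a real number that is not an integer, and c : Fin N → ℂ arbitrary complex coefficients. Then for every k ∈ {0, …, N−1}, the normalized FFT output of the frequency-offset OFDM signal decomposes exactly as (1/N) Σ_{n=0}^{N−1} ( Σ_{l=0}^{N−1} c_l e^{2πi n (l+ϑ)/N} ) e^{−2πi n k/N} = e^{iπ(N−1)ϑ/N} · ( sin(πϑ) / (N sin(πϑ/N)) ) · c_k + Σ_{l ≠ k} e^{iπ(N−1)(l−k+ϑ)/N} · ( sin(π(l−k+ϑ)) / (N sin(π(l−k+ϑ)/N)) ) · c_l, where the first term is the attenuated and phase-rotated desired symbol and the second term is the interchannel interference (ICI). -/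
open Complex Finset

/-- The Dirichlet-kernel form of a geometric sum of complex exponentials. -/
lemma sum_range_exp_mul_sin (N : ℕ) (z : ℂ) :
    (∑ n ∈ Finset.range N, Complex.exp (2 * Complex.I * n * z)) * Complex.sin z =
      Complex.exp (Complex.I * ((N : ℂ) - 1) * z) * Complex.sin (N * z) := by
  induction N with
  | zero => simp
  | succ N ih =>
    have h₁ : Complex.exp (Complex.I * ((N : ℂ) - 1) * z) =
        Complex.exp (N * z * Complex.I) * Complex.exp (-z * Complex.I) := by
      rw [← Complex.exp_add]; ring_nf
    have h₂ : Complex.exp (2 * Complex.I * N * z) =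
        Complex.exp (N * z * Complex.I) * Complex.exp (N * z * Complex.I) := by
      rw [← Complex.exp_add]; ring_nf
    have h₃ : Complex.exp (Complex.I * (((N + 1 : ℕ) : ℂ) - 1) * z) =
        Complex.exp (N * z * Complex.I) := by
      push_cast; ring_nf
    have h₄ : Complex.sin (((N + 1 : ℕ) : ℂ) * z) =
        Complex.sin (N * z) * Complex.cos z + Complex.cos (N * z) * Complex.sin z := by
      rw [← Complex.sin_add]; push_cast; ring_nf
    rw [Finset.sum_range_succ, add_mul, ih, h₁, h₂, h₃, h₄, Complex.exp_mul_I, Complex.exp_mul_I,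
      Complex.cos_neg, Complex.sin_neg]
    ring

/-- The normalized sum of the samples of a complex exponential of frequency `x ∉ ℤ`. -/
lemma normalized_sum_range_exp {N : ℕ} (hN : 0 < N) {x : ℝ} (hx : ∀ m : ℤ, x ≠ m) :
    (1 / (N : ℂ)) * ∑ n ∈ Finset.range N,
        Complex.exp (2 * Real.pi * Complex.I * (n : ℂ) * (x : ℂ) / (N : ℂ)) =
      Complex.exp (Complex.I * Real.pi * ((N : ℂ) - 1) * (x : ℂ) / (N : ℂ)) *
        ((Real.sin (Real.pi * x) / (N * Real.sin (Real.pi * x / N)) : ℝ) : ℂ) := by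
  have hN' : (N : ℝ) ≠ 0 := by positivity
  have hNC : (N : ℂ) ≠ 0 := by exact_mod_cast hN'
  have hsin : Real.sin (Real.pi * x / N) ≠ 0 := by
    intro h
    obtain ⟨m, hm⟩ := Real.sin_eq_zero_iff.mp h
    apply hx (m * N)
    have := Real.pi_ne_zero
    field_simp at hm
    push_cast
    linarith
  have hsinC : Complex.sin (Real.pi * x / N) ≠ 0 := by exact_mod_cast hsin
  have h := sum_range_exp_mul_sin N (Real.pi * x / N)
  rw [mul_div_cancel₀ _ hNC, ← eq_div_iff hsinC] at h
  have hsum : ∑ n ∈ Finset.range N,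
        Complex.exp (2 * Real.pi * Complex.I * (n : ℂ) * (x : ℂ) / (N : ℂ)) =
      ∑ n ∈ Finset.range N, Complex.exp (2 * Complex.I * n * (Real.pi * x / N)) :=
    Finset.sum_congr rfl fun n _ => by ring_nf
  have hphase : Complex.I * Real.pi * ((N : ℂ) - 1) * (x : ℂ) / (N : ℂ) =
      Complex.I * ((N : ℂ) - 1) * (Real.pi * x / N) := by ring
  rw [hsum, h, hphase]
  push_cast
  field_simp

/-- **Exact FFT output of a frequency-offset OFDM symbol (equations (30)–(31) of the paper).**
With a normalized carrier frequency offset `ϑ ∉ ℤ`, the normalized DFT output at subcarrier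
`k` decomposes exactly into the attenuated, phase-rotated desired symbol plus the
interchannel interference (ICI) from all other subcarriers. -/
theorem ofdm_frequency_offset_decomposition
    (N : ℕ) (hN : 0 < N) (ϑ : ℝ) (hϑ : ∀ m : ℤ, ϑ ≠ (m : ℝ)) (c : Fin N → ℂ) (k : Fin N) :
    (1 / (N : ℂ)) *
        ∑ n ∈ Finset.range N,
          (∑ l : Fin N,
              c l * Complex.exp (2 * Real.pi * Complex.I * (n : ℂ) * (((l : ℕ) : ℂ) + (ϑ : ℂ)) / (N : ℂ)))
            * Complex.exp (-(2 * Real.pi * Complex.I * (n : ℂ) * ((k : ℕ) : ℂ) / (N : ℂ)))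
      = Complex.exp (Complex.I * Real.pi * ((N : ℂ) - 1) * (ϑ : ℂ) / (N : ℂ)) *
            ((Real.sin (Real.pi * ϑ) / (N * Real.sin (Real.pi * ϑ / N)) : ℝ) : ℂ) * c k
        + ∑ l ∈ Finset.univ.erase k,
            Complex.exp (Complex.I * Real.pi * ((N : ℂ) - 1) *
                ((((l : ℕ) : ℝ) - ((k : ℕ) : ℝ) + ϑ : ℝ) : ℂ) / (N : ℂ)) *
              ((Real.sin (Real.pi * (((l : ℕ) : ℝ) - ((k : ℕ) : ℝ) + ϑ)) /
                  (N * Real.sin (Real.pi * (((l : ℕ) : ℝ) - ((k : ℕ) : ℝ) + ϑ) / N)) : ℝ) : ℂ) *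
              c l := by
  have hx (l : Fin N) (m : ℤ) : (((l : ℕ) : ℝ) - ((k : ℕ) : ℝ) + ϑ) ≠ m := fun h =>
    hϑ (m - (l : ℕ) + (k : ℕ)) (by push_cast; linarith)
  have hmain : ∀ l : Fin N, _ := fun l => normalized_sum_range_exp hN (hx l)
  have hk := normalized_sum_range_exp hN hϑ
  simp only [← hmain, ← hk]
  have hk' : (ϑ : ℂ) = ((((k : ℕ) : ℝ) - ((k : ℕ) : ℝ) + ϑ : ℝ) : ℂ) := by simp
  conv_rhs => rw [hk']
  rw [Finset.add_sum_erase Finset.univ (fun l : Fin N => (1 / (N : ℂ)) * (∑ n ∈ Finset.range N,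
      Complex.exp (2 * Real.pi * Complex.I * (n : ℂ) *
        ((((l : ℕ) : ℝ) - ((k : ℕ) : ℝ) + ϑ : ℝ) : ℂ) / (N : ℂ))) * c l) (Finset.mem_univ k)]
  simp only [Finset.sum_mul, Finset.mul_sum]
  rw [Finset.sum_comm]
  refine Finset.sum_congr rfl fun l _ => Finset.sum_congr rfl fun n _ => ?_
  rw [mul_assoc (c l), ← Complex.exp_add]
  push_cast
  ring_nf
end

section
/- Let β ≥ 0 and let g(x) = e^{β cos x} / (2π I₀(β)) be the Tikhonov density on (−π, π]. Let f : ℝ → ℝ be any measurable function with f ≥ 0, f vanishing outside (−π, π], ∫_{−π}^{π} f(x) dx = 1, satisfying the circular-mean constraints ∫_{−π}^{π} f(x) cos x dx = ∫_{−π}^{π} g(x) cos x dx and ∫_{−π}^{π} f(x) sin x dx = 0, and such that x ↦ f(x) log f(x) is integrable on (−π, π] (with the convention 0·log 0 = 0). Then the differential entropy of f is at most that of g: −∫_{−π}^{π} f(x) log f(x) dx ≤ −∫_{−π}^{π} g(x) log g(x) dx, with the Tikhonov density g attaining the maximum. -/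
open MeasureTheory

/-- The Tikhonov density with concentration parameter `β`:
`g(x) = e^{β cos x} / (2π I₀(β))`. -/
noncomputable def tikhonovDensity (β : ℝ) (x : ℝ) : ℝ :=
    Real.exp (β * Real.cos x) / (2 * Real.pi * besselI0 β)

open scoped Nat

theorem integral_cos_pow_neg_pi_pi_add_two (n : ℕ) :
    ∫ x in (-Real.pi)..Real.pi, Real.cos x ^ (n + 2) =
      (n + 1) / (n + 2) * ∫ x in (-Real.pi)..Real.pi, Real.cos x ^ n := by
  simp [integral_cos_pow]

theorem integral_cos_pow_odd_neg_pi_pi (k : ℕ) :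
    ∫ x in (-Real.pi)..Real.pi, Real.cos x ^ (2 * k + 1) = 0 := by
  induction k with
  | zero => simp
  | succ k ih =>
    rw [show 2 * (k + 1) + 1 = 2 * k + 1 + 2 by ring, integral_cos_pow_neg_pi_pi_add_two, ih,
      mul_zero]

theorem integral_cos_pow_even_neg_pi_pi (k : ℕ) :
    ∫ x in (-Real.pi)..Real.pi, Real.cos x ^ (2 * k) =
      2 * Real.pi * ((2 * k)! / (4 ^ k * (k ! : ℝ) ^ 2)) := by
  induction k with
  | zero => simp; ring
  | succ k ih =>
    rw [show 2 * (k + 1) = 2 * k + 2 by ring, integral_cos_pow_neg_pi_pi_add_two, ih,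
      Nat.factorial_succ (2 * k + 1), Nat.factorial_succ (2 * k), Nat.factorial_succ k]
    push_cast
    have := Nat.cast_ne_zero (R := ℝ).mpr k.factorial_ne_zero
    field_simp
    ring

/-- The integral representation of the modified Bessel function `I₀`. -/
theorem integral_exp_mul_cos (β : ℝ) :
    ∫ x in (-Real.pi)..Real.pi, Real.exp (β * Real.cos x) = 2 * Real.pi * besselI0 β := by
  have h : HasSum (fun n : ℕ => ∫ x in (-Real.pi)..Real.pi, (β * Real.cos x) ^ n / n !)
      (∫ x in (-Real.pi)..Real.pi, Real.exp (β * Real.cos x)) := by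
    refine intervalIntegral.hasSum_integral_of_dominated_convergence
      (fun n _ => |β| ^ n / n !) (fun n => ?_) (fun n => ?_) ?_ ?_ ?_
    · exact (by fun_prop : Continuous fun x => (β * Real.cos x) ^ n / (n ! : ℝ)).aestronglyMeasurable
    · refine .of_forall fun x _ => ?_
      rw [norm_div, norm_pow, norm_mul, Real.norm_natCast, Real.norm_eq_abs, Real.norm_eq_abs]
      gcongr
      exact mul_le_of_le_one_right (abs_nonneg β) (Real.abs_cos_le_one x)
    · exact .of_forall fun x _ => Real.summable_pow_div_factorial |β|
    · exact intervalIntegrable_const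
    · refine .of_forall fun x _ => ?_
      rw [Real.exp_eq_exp_ℝ]
      exact NormedSpace.expSeries_div_hasSum_exp (β * Real.cos x)
  have hterm (n : ℕ) : ∫ x in (-Real.pi)..Real.pi, (β * Real.cos x) ^ n / n ! =
      β ^ n / n ! * ∫ x in (-Real.pi)..Real.pi, Real.cos x ^ n := by
    rw [← intervalIntegral.integral_const_mul]
    congr 1 with x
    ring
  have hinj : Function.Injective fun k : ℕ => 2 * k := mul_right_injective₀ two_ne_zero
  rw [← hinj.hasSum_iff] at h
  · rw [besselI0, ← tsum_mul_left, ← h.tsum_eq]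
    congr 1 with k
    have := Nat.cast_ne_zero (R := ℝ).mpr k.factorial_ne_zero
    have := Nat.cast_ne_zero (R := ℝ).mpr (2 * k).factorial_ne_zero
    rw [Function.comp_apply, hterm, integral_cos_pow_even_neg_pi_pi, div_pow, pow_mul 2 2 k]
    field_simp
    norm_num
  · intro n hn
    obtain ⟨k, rfl⟩ : Odd n := by
      rw [← Nat.not_even_iff_odd, even_iff_exists_two_mul]
      rintro ⟨k, rfl⟩
      exact hn ⟨k, rfl⟩
    rw [hterm, integral_cos_pow_odd_neg_pi_pi, mul_zero]

theorem besselI0_pos (β : ℝ) : 0 < besselI0 β := by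
  have h : 0 < ∫ x in (-Real.pi)..Real.pi, Real.exp (β * Real.cos x) :=
    intervalIntegral.intervalIntegral_pos_of_pos
      (Continuous.intervalIntegrable (by fun_prop) _ _) (fun x => Real.exp_pos _)
      (by linarith [Real.pi_pos])
  rw [integral_exp_mul_cos] at h
  exact pos_of_mul_pos_right h (by positivity)

theorem tikhonovDensity_pos (β x : ℝ) : 0 < tikhonovDensity β x := by
  have := besselI0_pos β
  unfold tikhonovDensity
  positivity

@[fun_prop]
theorem continuous_tikhonovDensity (β : ℝ) : Continuous (tikhonovDensity β) := by
  unfold tikhonovDensity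
  fun_prop

theorem log_tikhonovDensity (β x : ℝ) :
    Real.log (tikhonovDensity β x) = β * Real.cos x - Real.log (2 * Real.pi * besselI0 β) := by
  have := besselI0_pos β
  rw [tikhonovDensity, Real.log_div (Real.exp_pos _).ne' (by positivity), Real.log_exp]

theorem integral_tikhonovDensity (β : ℝ) :
    ∫ x in (-Real.pi)..Real.pi, tikhonovDensity β x = 1 := by
  have := besselI0_pos β
  simp only [tikhonovDensity]
  rw [intervalIntegral.integral_div, integral_exp_mul_cos, div_self (by positivity)]

/-- The pointwise form of Gibbs' inequality. -/
theorem mul_log_sub_mul_log_le_sub {a b : ℝ} (ha : 0 ≤ a) (hb : 0 < b) :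
    a * Real.log b - a * Real.log a ≤ b - a := by
  rcases ha.eq_or_lt with rfl | ha
  · simpa using hb.le
  · have h := mul_le_mul_of_nonneg_left (Real.log_le_sub_one_of_pos (div_pos hb ha)) ha.le
    rw [Real.log_div hb.ne' ha.ne', mul_sub, mul_sub, mul_div_cancel₀ _ ha.ne', mul_one] at h
    exact h

/-- The integral of `h` against the logarithm of the Tikhonov density depends only on the mass and
the cosine moment of `h`. -/
theorem integral_mul_log_tikhonovDensity (β : ℝ) {h : ℝ → ℝ}
    (hh : IntervalIntegrable h volume (-Real.pi) Real.pi) :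
    ∫ x in (-Real.pi)..Real.pi, h x * Real.log (tikhonovDensity β x) =
      β * (∫ x in (-Real.pi)..Real.pi, h x * Real.cos x) -
        Real.log (2 * Real.pi * besselI0 β) * ∫ x in (-Real.pi)..Real.pi, h x := by
  rw [← intervalIntegral.integral_const_mul, ← intervalIntegral.integral_const_mul,
    ← intervalIntegral.integral_sub]
  · congr 1 with x
    rw [log_tikhonovDensity]
    ring
  · exact (hh.mul_continuousOn Real.continuous_cos.continuousOn).const_mul β
  · exact hh.const_mul _

/-- **Maximum-entropy property of the Tikhonov distribution.**  Among all probability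
densities `f` on `(-π, π]` with the same circular-mean constraints
`∫ f cos = ∫ g cos` and `∫ f sin = 0` as the Tikhonov density `g` (with `β ≥ 0`), and whose
entropy integrand `f log f` is integrable, the differential entropy `-∫ f log f` is maximized
by `g`:  `-∫ f log f ≤ -∫ g log g`. -/
theorem tikhonov_max_entropy
    (β : ℝ) (hβ : 0 ≤ β) (f : ℝ → ℝ) (hf_meas : Measurable f)
    (hf_nonneg : ∀ x, 0 ≤ f x)
    (hf_supp : ∀ x, x ∉ Set.Ioc (-Real.pi) Real.pi → f x = 0)
    (hf_prob : (∫ x in (-Real.pi)..Real.pi, f x) = 1)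
    (hf_cos : (∫ x in (-Real.pi)..Real.pi, f x * Real.cos x)
      = ∫ x in (-Real.pi)..Real.pi, tikhonovDensity β x * Real.cos x)
    (hf_sin : (∫ x in (-Real.pi)..Real.pi, f x * Real.sin x) = 0)
    (hf_ent : IntegrableOn (fun x => f x * Real.log (f x)) (Set.Ioc (-Real.pi) Real.pi)) :
    -(∫ x in (-Real.pi)..Real.pi, f x * Real.log (f x))
      ≤ -(∫ x in (-Real.pi)..Real.pi, tikhonovDensity β x * Real.log (tikhonovDensity β x)) := by
  have hpi : -Real.pi ≤ Real.pi := by linarith [Real.pi_pos]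
  have hf_int : IntervalIntegrable f volume (-Real.pi) Real.pi := by
    by_contra h
    simp [intervalIntegral.integral_undef h] at hf_prob
  have hg_int : IntervalIntegrable (tikhonovDensity β) volume (-Real.pi) Real.pi :=
    (continuous_tikhonovDensity β).intervalIntegrable _ _
  have hf_ent' : IntervalIntegrable (fun x => f x * Real.log (f x)) volume (-Real.pi) Real.pi :=
    (intervalIntegrable_iff_integrableOn_Ioc_of_le hpi).2 hf_ent
  have hcross : IntervalIntegrable (fun x => f x * Real.log (tikhonovDensity β x)) volume
      (-Real.pi) Real.pi :=
    hf_int.mul_continuousOn ((continuous_tikhonovDensity β).log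
      fun x => (tikhonovDensity_pos β x).ne').continuousOn
  have hmono := intervalIntegral.integral_mono hpi (hcross.sub hf_ent') (hg_int.sub hf_int)
    fun x => mul_log_sub_mul_log_le_sub (hf_nonneg x) (tikhonovDensity_pos β x)
  rw [intervalIntegral.integral_sub hcross hf_ent', intervalIntegral.integral_sub hg_int hf_int,
    integral_mul_log_tikhonovDensity β hf_int, hf_prob, hf_cos, integral_tikhonovDensity] at hmono
  rw [integral_mul_log_tikhonovDensity β hg_int, integral_tikhonovDensity]
  linarith
end
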